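/- arXiv:1504.05925 — 3 statements merged into one kernel-verified Lean document; each statement's English description precedes it below -/
import Mathlib

section
/- Let 𝔩 be a finite-dimensional real semisimple Lie algebra with negative definite Killing form B, let s be an involutive Lie algebra automorphism of 𝔩 with eigenspaces 𝔨 = {x : s(x) = x} and 𝔣 = {x : s(x) = −x}, assume 𝔣 ≠ {0}, that the only ad(𝔨)-invariant subspaces of 𝔣 are {0} and 𝔣, and that 𝔨 contains a nonzero ideal of 𝔩. Let 𝔲 be the sum of all ideals of 𝔩 contained in 𝔨 and let 𝔩̃ be the B-orthogonal complement of 𝔲 in 𝔩. Then 𝔩̃ is an ideal of 𝔩, 𝔩 = 𝔲 ⊕ 𝔩̃, s(𝔩̃) = 𝔩̃, 𝔣 = {x ∈ 𝔩̃ : s(x) = −x}, and 𝔨 ∩ 𝔩̃ contains no nonzero ideal of 𝔩̃. -/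
/-- The `-1`-eigenspace `𝔣 = {x | s x = -x}` of an involutive automorphism `s`. -/
def negEigenspace {L : Type*} [LieRing L] [LieAlgebra ℝ L]
    (s : L →ₗ⁅ℝ⁆ L) : Submodule ℝ L :=
  LinearMap.ker (s.toLinearMap + LinearMap.id)

/-- The sum `𝔲` of all ideals of `𝔩` contained in `𝔨 = {x | s x = x}`. -/
def idealsInFixedSum {L : Type*} [LieRing L] [LieAlgebra ℝ L]
    (s : L →ₗ⁅ℝ⁆ L) : Submodule ℝ L :=
  ⨆ (I : LieIdeal ℝ L) (_ : ∀ y ∈ I, s y = y), (I : Submodule ℝ L)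

/-- the type-S2 construction in the proof of Lemma 5.1 of the paper:
for `𝔩` semisimple with negative definite Killing form `B`, `s` an involutive
automorphism with eigenspaces `𝔨`, `𝔣`, with `𝔣 ≠ 0` irreducible under `ad 𝔨`
and `𝔨` containing a nonzero ideal, the `B`-orthogonal complement `𝔩̃` of the
sum `𝔲` of all ideals contained in `𝔨` is an ideal, `𝔩 = 𝔲 ⊕ 𝔩̃`,
`s(𝔩̃) = 𝔩̃`, `𝔣 = {x ∈ 𝔩̃ : s x = -x}`, and `𝔨 ∩ 𝔩̃` contains no nonzero
ideal of `𝔩̃`. -/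
theorem stmt_7
    (L : Type*) [LieRing L] [LieAlgebra ℝ L] [FiniteDimensional ℝ L]
    (hBneg : ∀ x : L, x ≠ 0 → killingForm ℝ L x x < 0)
    (hss : ∀ x : L, (∀ y : L, killingForm ℝ L x y = 0) → x = 0)
    (s : L →ₗ⁅ℝ⁆ L) (hs : ∀ x, s (s x) = x)
    (hfne : negEigenspace s ≠ ⊥)
    (hirr : ∀ W : Submodule ℝ L, W ≤ negEigenspace s →
      (∀ c : L, s c = c → ∀ w ∈ W, ⁅c, w⁆ ∈ W) → W = ⊥ ∨ W = negEigenspace s)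
    (hideal : ∃ I : LieIdeal ℝ L, I ≠ ⊥ ∧ (∀ y ∈ I, s y = y)) :
    (∀ x : L, ∀ y ∈ (killingForm ℝ L).orthogonal (idealsInFixedSum s),
        ⁅x, y⁆ ∈ (killingForm ℝ L).orthogonal (idealsInFixedSum s))
    ∧ IsCompl (idealsInFixedSum s) ((killingForm ℝ L).orthogonal (idealsInFixedSum s))
    ∧ Submodule.map s.toLinearMap ((killingForm ℝ L).orthogonal (idealsInFixedSum s))
        = (killingForm ℝ L).orthogonal (idealsInFixedSum s)
    ∧ (∀ x : L, x ∈ negEigenspace s ↔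
        (x ∈ (killingForm ℝ L).orthogonal (idealsInFixedSum s) ∧ s x = -x))
    ∧ (∀ J : Submodule ℝ L, J ≤ (killingForm ℝ L).orthogonal (idealsInFixedSum s) →
        (∀ x ∈ (killingForm ℝ L).orthogonal (idealsInFixedSum s), ∀ y ∈ J, ⁅x, y⁆ ∈ J) →
        (∀ y ∈ J, s y = y) → J = ⊥) := by
  have hK : LieAlgebra.IsKilling ℝ L := by
    refine ⟨?_⟩
    rw [eq_bot_iff]
    intro x hx
    rw [LieIdeal.mem_killingCompl] at hx
    rw [LieSubmodule.mem_bot]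
    apply hss
    intro y
    rw [LieModule.traceForm_comm]
    exact hx y (LieSubmodule.mem_top y)
  obtain ⟨U, hU⟩ : ∃ U : LieIdeal ℝ L, LieSubmodule.toSubmodule U = idealsInFixedSum s := by
    refine ⟨⨆ (I : LieIdeal ℝ L) (_ : ∀ y ∈ I, s y = y), I, ?_⟩
    simp only [LieSubmodule.iSup_toSubmodule]
    rfl
  have hfix : ∀ y ∈ U, s y = y := by
    have h : idealsInFixedSum s ≤ LinearMap.ker (s.toLinearMap - LinearMap.id) := by
      refine iSup₂_le fun I hI y hy => ?_
      simpa [sub_eq_zero] using hI y hy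
    intro y hy
    have h2 : y ∈ idealsInFixedSum s := by rw [← hU]; exact hy
    simpa [sub_eq_zero] using h h2
  have hle : ∀ I : LieIdeal ℝ L, (∀ y ∈ I, s y = y) → I ≤ U := by
    intro I hI
    rw [← LieSubmodule.toSubmodule_le_toSubmodule, hU]
    exact le_iSup₂_of_le I hI le_rfl
  let e : L ≃ₗ⁅ℝ⁆ L := { s with invFun := s, left_inv := hs, right_inv := hs }
  have hB : ∀ x y, killingForm ℝ L (s x) (s y) = killingForm ℝ L x y := fun x y =>
    LieAlgebra.killingForm_of_equiv_apply e x y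
  have hc := LieIdeal.isCompl_killingCompl (K := ℝ) U
  rw [← hU, ← LieIdeal.toSubmodule_killingCompl]
  have hsinv : ∀ x ∈ U.killingCompl, s x ∈ U.killingCompl := by
    intro x hx
    rw [LieIdeal.mem_killingCompl] at hx ⊢
    intro y hy
    rw [← hfix y hy, hB]
    exact hx y hy
  have hneg : ∀ x, x ∈ negEigenspace s ↔ s x = -x := by
    intro x
    simp [negEigenspace, add_eq_zero_iff_eq_neg]
  refine ⟨fun x y hy => U.killingCompl.lie_mem hy, ?_, ?_, ?_, ?_⟩
  · rwa [LieSubmodule.isCompl_toSubmodule]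
  · apply le_antisymm
    · rintro _ ⟨x, hx, rfl⟩
      exact hsinv x hx
    · intro x hx
      exact ⟨s x, hsinv x hx, hs x⟩
  · intro x
    rw [hneg]
    refine ⟨fun h => ⟨?_, h⟩, fun h => h.2⟩
    rw [LieSubmodule.mem_toSubmodule, LieIdeal.mem_killingCompl]
    intro y hy
    have := hB y x
    rw [hfix y hy, h, map_neg] at this
    linarith
  · intro J hJ hJi hJs
    have hJid : ∀ x : L, ∀ y ∈ J, ⁅x, y⁆ ∈ J := by
      intro x y hy
      have hx : x ∈ U ⊔ U.killingCompl := by rw [hc.sup_eq_top]; exact LieSubmodule.mem_top x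
      obtain ⟨u, hu, v, hv, rfl⟩ := (LieSubmodule.mem_sup _ _ _).1 hx
      rw [add_lie]
      have h0 : ⁅u, y⁆ ∈ U ⊓ U.killingCompl :=
        ⟨lie_mem_left ℝ L U u y hu, U.killingCompl.lie_mem (hJ hy)⟩
      rw [hc.inf_eq_bot, LieSubmodule.mem_bot] at h0
      rw [h0, zero_add]
      exact hJi v hv y hy
    let I : LieIdeal ℝ L := { J with lie_mem := fun {x y} hy => hJid x y hy }
    have hIU : I ≤ U := hle I hJs
    rw [eq_bot_iff]
    intro y hy
    have h0 : y ∈ U ⊓ U.killingCompl := ⟨hIU hy, hJ hy⟩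
    rw [hc.inf_eq_bot, LieSubmodule.mem_bot] at h0
    simpa using h0
end

section
/- Let 𝔩 be a finite-dimensional real Lie algebra admitting an ad-invariant inner product (an inner product with ⟨[x,y],z⟩ = −⟨y,[x,z]⟩ for all x,y,z). Let s be an involutive Lie algebra automorphism of 𝔩 with eigenspaces 𝔨 = {x : s(x) = x} and 𝔣 = {x : s(x) = −x}, and assume 𝔣 ≠ {0} and that the only ad(𝔨)-invariant subspaces of 𝔣 are {0} and 𝔣. Then 𝔣 ⊆ 𝔷(𝔩) or 𝔣 ⊆ [𝔩,𝔩], where 𝔷(𝔩) denotes the center of 𝔩. -/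
/-- for a compact Lie algebra `𝔩` (one admitting an ad-invariant
inner product) and an involutive automorphism `s` with eigenspaces `𝔨`, `𝔣`,
if `𝔣 ≠ 0` and the only `ad(𝔨)`-invariant subspaces of `𝔣` are `0` and `𝔣`,
then `𝔣 ⊆ 𝔷(𝔩)` or `𝔣 ⊆ [𝔩,𝔩]`. -/
theorem stmt_8
    (L : Type*) [LieRing L] [LieAlgebra ℝ L] [FiniteDimensional ℝ L]
    (Φ : L →ₗ[ℝ] L →ₗ[ℝ] ℝ)
    (hΦsymm : ∀ x y : L, Φ x y = Φ y x)
    (hΦpos : ∀ x : L, x ≠ 0 → 0 < Φ x x)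
    (hΦinv : ∀ x y z : L, Φ ⁅x, y⁆ z = -Φ y ⁅x, z⁆)
    (s : L →ₗ⁅ℝ⁆ L) (hs : ∀ x, s (s x) = x)
    (hfne : negEigenspace s ≠ ⊥)
    (hirr : ∀ W : Submodule ℝ L, W ≤ negEigenspace s →
      (∀ c : L, s c = c → ∀ w ∈ W, ⁅c, w⁆ ∈ W) → W = ⊥ ∨ W = negEigenspace s) :
    negEigenspace s ≤ (LieAlgebra.center ℝ L).toSubmodule
    ∨ negEigenspace s ≤ (LieAlgebra.derivedSeries ℝ L 1).toSubmodule := by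
  have hmem : ∀ x, x ∈ negEigenspace s ↔ s x = -x := by
    intro x
    simp [negEigenspace, LinearMap.mem_ker, add_eq_zero_iff_eq_neg]
  have hder : ∀ x y : L, ⁅x, y⁆ ∈ (LieAlgebra.derivedSeries ℝ L 1).toSubmodule := by
    intro x y
    have h : ⁅x, y⁆ ∈ ⁅(⊤ : LieIdeal ℝ L), (⊤ : LieIdeal ℝ L)⁆ :=
      LieSubmodule.lie_mem_lie (LieSubmodule.mem_top x) (LieSubmodule.mem_top y)
    exact h
  have hkf : ∀ c w : L, s c = c → s w = -w → s ⁅c, w⁆ = -⁅c, w⁆ := by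
    intro c w hc hw
    rw [LieHom.map_lie, hc, hw, lie_neg]
  rcases hirr (negEigenspace s ⊓ (LieAlgebra.derivedSeries ℝ L 1).toSubmodule) inf_le_left
    (fun c hc w hw => ⟨(hmem _).2 (hkf c w hc ((hmem w).1 hw.1)), hder c w⟩) with h | h
  · left
    have hkf0 : ∀ c w : L, s c = c → s w = -w → ⁅c, w⁆ = 0 := by
      intro c w hc hw
      have h1 : ⁅c, w⁆ ∈ negEigenspace s ⊓ (LieAlgebra.derivedSeries ℝ L 1).toSubmodule :=
        ⟨(hmem _).2 (hkf c w hc hw), hder c w⟩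
      rw [h] at h1
      exact (Submodule.mem_bot ℝ).1 h1
    have hff0 : ∀ x y : L, s x = -x → s y = -y → ⁅x, y⁆ = 0 := by
      intro x y hx hy
      by_contra hne
      have h1 := hΦpos _ hne
      have h2 : ⁅⁅x, y⁆, x⁆ = 0 := by
        apply hkf0 _ _ _ hx
        rw [LieHom.map_lie, hx, hy, lie_neg, neg_lie, neg_neg]
      rw [hΦinv, ← lie_skew x ⁅x, y⁆, h2] at h1
      simp at h1
    intro x hx
    have hx' := (hmem x).1 hx
    have key : ∀ y : L, ⁅y, x⁆ = 0 := by
      intro y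
      have h1 : ⁅y + s y, x⁆ = 0 := hkf0 _ _ (by rw [map_add, hs, add_comm]) hx'
      have h2 : ⁅y - s y, x⁆ = 0 := hff0 _ _ (by rw [map_sub, hs, neg_sub]) hx'
      rw [add_lie] at h1
      rw [sub_lie] at h2
      have h3 : (2 : ℝ) • ⁅y, x⁆ = 0 := by
        rw [two_smul]
        calc ⁅y, x⁆ + ⁅y, x⁆ = (⁅y, x⁆ + ⁅s y, x⁆) + (⁅y, x⁆ - ⁅s y, x⁆) := by abel
          _ = 0 := by rw [h1, h2, add_zero]
      exact (smul_eq_zero.1 h3).resolve_left two_ne_zero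
    exact (LieModule.mem_maxTrivSubmodule ℝ L L x).2 key
  · right
    rw [← h]
    exact inf_le_right
end

section
/- Let 𝔩 be a finite-dimensional real Lie algebra with center 𝔷(𝔩) ≠ {0}. Let s be an involutive Lie algebra automorphism of 𝔩 with eigenspaces 𝔨 = {x : s(x) = x} and 𝔣 = {x : s(x) = −x}. Assume 𝔣 ≠ {0}, that the only ad(𝔨)-invariant subspaces of 𝔣 are {0} and 𝔣, and that 𝔨 contains no nonzero ideal of 𝔩. Then 𝔣 = 𝔷(𝔩). -/
/-- type NS0 in the proof of Lemma 5.1 of the paper: if `𝔩` has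
nonzero center, `s` is an involutive automorphism with eigenspaces `𝔨`, `𝔣`,
`𝔣 ≠ 0`, the only `ad(𝔨)`-invariant subspaces of `𝔣` are `0` and `𝔣`, and `𝔨`
contains no nonzero ideal of `𝔩`, then `𝔣 = 𝔷(𝔩)`. -/
theorem stmt_9
    (L : Type*) [LieRing L] [LieAlgebra ℝ L] [FiniteDimensional ℝ L]
    (hz : LieAlgebra.center ℝ L ≠ ⊥)
    (s : L →ₗ⁅ℝ⁆ L) (hs : ∀ x, s (s x) = x)
    (hfne : negEigenspace s ≠ ⊥)
    (hirr : ∀ W : Submodule ℝ L, W ≤ negEigenspace s →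
      (∀ c : L, s c = c → ∀ w ∈ W, ⁅c, w⁆ ∈ W) → W = ⊥ ∨ W = negEigenspace s)
    (hnoideal : ∀ I : LieIdeal ℝ L, (∀ y ∈ I, s y = y) → I = ⊥) :
    negEigenspace s = (LieAlgebra.center ℝ L).toSubmodule := by
  have hc : ∀ x : L, x ∈ LieAlgebra.center ℝ L ↔ ∀ y : L, ⁅y, x⁆ = 0 := fun x =>
    LieModule.mem_maxTrivSubmodule ℝ L L x
  have hfix : ∀ x : L, (∀ y : L, ⁅y, x⁆ = 0) → s x = x → x = 0 := by
    intro x hx hsx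
    let I : LieIdeal ℝ L :=
      { carrier := {a | (∀ y : L, ⁅y, a⁆ = 0) ∧ s a = a}
        add_mem' := by
          rintro a b ⟨ha, ha2⟩ ⟨hb, hb2⟩
          exact ⟨fun y => by rw [lie_add, ha, hb, add_zero], by rw [map_add, ha2, hb2]⟩
        zero_mem' := ⟨fun y => lie_zero y, map_zero s⟩
        smul_mem' := by
          rintro c a ⟨ha, ha2⟩
          exact ⟨fun y => by rw [lie_smul, ha, smul_zero], by rw [map_smul, ha2]⟩
        lie_mem := by
          rintro y a ⟨ha, ha2⟩
          rw [ha y]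
          exact ⟨fun y => lie_zero y, map_zero s⟩ }
    have hI : I = ⊥ := hnoideal I (fun y hy => hy.2)
    have hxI : x ∈ I := ⟨hx, hsx⟩
    rw [hI] at hxI
    exact (LieSubmodule.mem_bot x).1 hxI
  have hle : (LieAlgebra.center ℝ L).toSubmodule ≤ negEigenspace s := by
    intro x hx
    have hx' := (hc x).1 hx
    have h0 : s x + x = 0 := by
      apply hfix
      · intro y
        have h1 : ⁅y, s x⁆ = 0 := by
          rw [← hs y, ← LieHom.map_lie, hx', map_zero]
        rw [lie_add, h1, hx', add_zero]
      · rw [map_add, hs, add_comm]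
    exact h0
  rcases hirr _ hle (fun c _ w hw => by
    rw [(hc w).1 hw c]; exact Submodule.zero_mem _) with h | h
  · exact absurd ((LieSubmodule.toSubmodule_eq_bot _).1 h) hz
  · exact h.symm
end
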